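/- arXiv:2003.02917 — 5 statements merged into one kernel-verified Lean document; each statement's English description precedes it below -/
import Mathlib

section
/- Let θ_1, …, θ_k ∈ ℝ and define the (k+1) × k matrix V_k(k) = (φ_k(e^{iθ_1}), …, φ_k(e^{iθ_k})) and the k × k matrix V_k(k−1) = (φ_{k−1}(e^{iθ_1}), …, φ_{k−1}(e^{iθ_k})), where φ_s(z) = (1, z, …, z^s)^T ∈ ℂ^{s+1}. If the θ_j give distinct nodes e^{iθ_j} (so both Gram determinants are nonzero), then √( det(V_k(k)* V_k(k)) / det(V_k(k−1)* V_k(k−1)) ) ≤ 2^k. -/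
open Matrix Complex

/-- The (s+1) × k Vandermonde-type matrix V_k(s) with columns φ_s(e^{iθ_j}). -/
noncomputable def vandR (k s : ℕ) (θ : Fin k → ℝ) : Matrix (Fin (s + 1)) (Fin k) ℂ :=
  Matrix.of fun i j => Complex.exp (Complex.I * (θ j : ℂ)) ^ (i : ℕ)

/-- The k × k square Vandermonde matrix V_k(k−1) with columns φ_{k−1}(e^{iθ_j}). -/
noncomputable def vandSq (k : ℕ) (θ : Fin k → ℝ) : Matrix (Fin k) (Fin k) ℂ :=
  Matrix.of fun i j => Complex.exp (Complex.I * (θ j : ℂ)) ^ (i : ℕ)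

/-- The lower coefficients of a monic polynomial of degree `k` over `ℂ` whose roots lie on the unit
circle have squared norms summing, together with the leading one, to at most `4 ^ k`. -/
theorem one_add_sum_normSq_coeff_le {k : ℕ} (z : Fin k → ℂ) (hz : ∀ j, ‖z j‖ = 1) :
    1 + ∑ i : Fin k, ‖(∏ j, (Polynomial.X - Polynomial.C (z j))).coeff i‖ ^ 2 ≤ (4 : ℝ) ^ k := by
  set p : Polynomial ℂ := ∏ j, (Polynomial.X - Polynomial.C (z j)) with hp
  have hdeg : p.natDegree = k := by simp [hp]
  have hmon : p.Monic := Polynomial.monic_prod_X_sub_C _ _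
  have hcoeff (i : ℕ) : ‖p.coeff i‖ ≤ k.choose i := by
    have h := Polynomial.coeff_le_of_roots_le (f := RingHom.id ℂ) (B := 1) (p := p) i hmon
      (IsAlgClosed.splits _) (by
        intro w hw
        rw [Polynomial.map_id, Polynomial.mem_roots hmon.ne_zero, Polynomial.IsRoot.def, hp,
          Polynomial.eval_prod, Finset.prod_eq_zero_iff] at hw
        obtain ⟨j, -, hj⟩ := hw
        rw [Polynomial.eval_sub, Polynomial.eval_X, Polynomial.eval_C, sub_eq_zero] at hj
        rw [hj, hz])
    simpa [hdeg] using h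
  calc 1 + ∑ i : Fin k, ‖p.coeff i‖ ^ 2
      ≤ 1 + ∑ i : Fin k, (k.choose i : ℝ) ^ 2 := by
        gcongr with i
        exact hcoeff i
    _ = ∑ i ∈ Finset.range (k + 1), (k.choose i : ℝ) ^ 2 := by
        rw [Finset.sum_range_succ, Finset.sum_range]
        simp [add_comm]
    _ ≤ 4 ^ k := by
        exact_mod_cast (Nat.sum_range_choose_sq k).trans_le (Nat.centralBinom_le_four_pow k)

/-- Each root `z j` of the monic polynomial `∏ l, (X - z l)` of degree `k` has its `k`-th power
expressed through the lower powers. -/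
theorem pow_eq_sum_neg_coeff {k : ℕ} (z : Fin k → ℂ) (j : Fin k) :
    z j ^ k = ∑ i : Fin k,
      -(∏ l, (Polynomial.X - Polynomial.C (z l))).coeff i * z j ^ (i : ℕ) := by
  set p : Polynomial ℂ := ∏ l, (Polynomial.X - Polynomial.C (z l)) with hp
  have hdeg : p.natDegree = k := by simp [hp]
  have hmon : p.Monic := Polynomial.monic_prod_X_sub_C _ _
  have hroot : p.eval (z j) = 0 := by
    rw [hp, Polynomial.eval_prod]
    exact Finset.prod_eq_zero (Finset.mem_univ j) (by simp)
  have hlead : p.coeff k = 1 := by simpa [hdeg] using hmon.coeff_natDegree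
  rw [Polynomial.eval_eq_sum_range, hdeg, Finset.sum_range_succ, hlead, one_mul,
    Finset.sum_range] at hroot
  simp only [neg_mul, Finset.sum_neg_distrib]
  exact eq_neg_of_add_eq_zero_right hroot

/-- If the last row of `vandR k k θ` is the combination `c` of the rows of `vandSq k θ`, then the
Gram determinants differ by the factor `1 + ‖c‖²`. -/
theorem det_gram_vandR {k : ℕ} (θ : Fin k → ℝ) (c : Fin k → ℂ)
    (hc : ∀ j, Complex.exp (Complex.I * (θ j : ℂ)) ^ k =
      ∑ i : Fin k, c i * Complex.exp (Complex.I * (θ j : ℂ)) ^ (i : ℕ)) :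
    ((vandR k k θ)ᴴ * vandR k k θ).det =
      ((1 + ∑ i, ‖c i‖ ^ 2 : ℝ) : ℂ) * ((vandSq k θ)ᴴ * vandSq k θ).det := by
  have hrow : vandR k k θ (Fin.last k) = c ᵥ* vandSq k θ := by
    ext j
    simpa [vandR, vandSq, Matrix.vecMul, dotProduct] using hc j
  have hgram : (vandR k k θ)ᴴ * vandR k k θ =
      (vandSq k θ)ᴴ * (1 + vecMulVec (star c) c) * vandSq k θ := by
    rw [mul_add, mul_one, add_mul, mul_vecMulVec, vecMulVec_mul, ← hrow]
    have hstar : (vandSq k θ)ᴴ *ᵥ star c = star (vandR k k θ (Fin.last k)) := by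
      rw [hrow, star_vecMul]
    rw [hstar]
    ext a b
    simp [Matrix.mul_apply, Fin.sum_univ_castSucc, vecMulVec_apply, vandR, vandSq]
  have hdet : (1 + vecMulVec (star c) c).det = ((1 + ∑ i, ‖c i‖ ^ 2 : ℝ) : ℂ) := by
    rw [vecMulVec_eq Unit, det_one_add_replicateCol_mul_replicateRow]
    simp [dotProduct, Complex.mul_conj, Complex.normSq_eq_norm_sq]
  rw [hgram, det_mul, det_mul, hdet, det_mul]
  ring

theorem det_vandSq_ne_zero {k : ℕ} {θ : Fin k → ℝ}
    (hdist : Function.Injective fun j => Complex.exp (Complex.I * (θ j : ℂ))) :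
    (vandSq k θ).det ≠ 0 := by
  rw [← det_transpose]
  exact det_vandermonde_ne_zero_iff.mpr hdist

theorem stmt5 (k : ℕ) (θ : Fin k → ℝ)
    (hdist : Function.Injective fun j => Complex.exp (Complex.I * (θ j : ℂ))) :
    Real.sqrt ((((vandR k k θ)ᴴ * vandR k k θ).det.re) /
        (((vandSq k θ)ᴴ * vandSq k θ).det.re)) ≤ 2 ^ k := by
  set z : Fin k → ℂ := fun j => Complex.exp (Complex.I * (θ j : ℂ)) with hz
  have hne : ((vandSq k θ)ᴴ * vandSq k θ).det.re ≠ 0 := by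
    have h : ((vandSq k θ)ᴴ * vandSq k θ).det = (Complex.normSq (vandSq k θ).det : ℂ) := by
      rw [det_mul, det_conjTranspose, mul_comm, ← Complex.mul_conj]
      rfl
    rw [h, Complex.ofReal_re]
    exact Complex.normSq_eq_zero.not.mpr (det_vandSq_ne_zero hdist)
  rw [det_gram_vandR θ _ (pow_eq_sum_neg_coeff z), Complex.re_ofReal_mul,
    mul_div_cancel_right₀ _ hne]
  refine Real.sqrt_le_iff.mpr ⟨by positivity, ?_⟩
  have hnorm (j : Fin k) : ‖z j‖ = 1 := by
    simp only [hz, mul_comm Complex.I]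
    exact Complex.norm_exp_ofReal_mul_I _
  calc _ ≤ (4 : ℝ) ^ k := by simpa only [norm_neg] using one_add_sum_normSq_coeff_le z hnorm
    _ = (2 ^ k) ^ 2 := by rw [← pow_mul, mul_comm, pow_mul]; norm_num
end

section
/- Let k ≥ 1 and −π/2 ≤ θ_1 < θ_2 < ⋯ < θ_{k+1} ≤ π/2 with θ_min = min_{p≠j} |θ_p − θ_j|. Then for all real numbers θ̂_1, …, θ̂_k, the maximum over 1 ≤ j ≤ k+1 of ∏_{q=1}^k |θ_j − θ̂_q| is at least ξ(k) θ_min^k, where ξ(1) = 1/2, ξ(k) = ((k−1)/2)! ((k−3)/2)!/4 for odd k ≥ 3, and ξ(k) = (((k−2)/2)!)²/4 for even k. -/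
open scoped Real
open Finset

/-- ξ(k) from the paper. -/
noncomputable def xiP (k : ℕ) : ℝ :=
  if k = 1 then 1 / 2
  else if k % 2 = 1 then
    (Nat.factorial ((k - 1) / 2) : ℝ) * (Nat.factorial ((k - 3) / 2) : ℝ) / 4
  else ((Nat.factorial ((k - 2) / 2) : ℝ)) ^ 2 / 4

theorem prod_abs_sub_eq_factorial_mul (j m : ℕ) :
    ∏ p ∈ range (j + m + 1), (if p = j then (1 : ℝ) else |(p : ℝ) - j|)
      = (j.factorial : ℝ) * (m.factorial : ℝ) := by
  induction m with
  | zero =>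
    rw [add_zero, prod_range_succ, ← prod_range_reflect,
      ← prod_range_add_one_eq_factorial j]
    push_cast
    simp only [if_true, mul_one, Nat.factorial_zero, Nat.cast_one]
    refine prod_congr rfl fun i hi => ?_
    have hi' : i + 1 ≤ j := by simpa [Nat.succ_le_iff] using hi
    have h : ((j - 1 - i : ℕ) : ℝ) = j - (i + 1) := by
      rw [Nat.sub_sub, add_comm 1 i, Nat.cast_sub hi']
      push_cast
      ring
    rw [if_neg (by omega), h, abs_of_nonpos (by linarith [(i.cast_nonneg : (0 : ℝ) ≤ i)])]
    ring
  | succ m ih =>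
    rw [prod_range_succ, ← add_assoc, ih, if_neg (by omega), Nat.factorial_succ]
    push_cast
    rw [abs_of_nonneg (by linarith [(m.cast_nonneg : (0 : ℝ) ≤ m)])]
    ring

theorem prod_erase_abs_sub_eq_factorial_mul (k : ℕ) (j : Fin (k + 1)) :
    ∏ p ∈ univ.erase j, |((p : ℕ) : ℝ) - (j : ℕ)|
      = ((j : ℕ).factorial : ℝ) * ((k - j : ℕ).factorial : ℝ) := by
  have h := prod_abs_sub_eq_factorial_mul j (k - j)
  rw [Nat.add_sub_cancel' (Nat.lt_succ_iff.mp j.isLt),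
    ← Fin.prod_univ_eq_prod_range (fun p : ℕ => if p = j then (1 : ℝ) else |(p : ℝ) - j|)] at h
  rw [← h, ← mul_prod_erase univ _ (mem_univ j), if_pos rfl, one_mul]
  refine prod_congr rfl fun p hp => ?_
  rw [if_neg fun h => ne_of_mem_erase hp (Fin.ext h)]

theorem mul_abs_sub_le_abs_sub_of_gap (k : ℕ) (θ : Fin (k + 1) → ℝ) (hmono : StrictMono θ)
    (δ : ℝ) (hδ : ∀ p j, p ≠ j → δ ≤ |θ p - θ j|) (p j : Fin (k + 1)) :
    δ * |((p : ℕ) : ℝ) - (j : ℕ)| ≤ |θ p - θ j| := by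
  have hmono' : Monotone fun i : Fin (k + 1) => θ i - δ * (i : ℕ) := by
    rw [Fin.monotone_iff_le_succ]
    intro i
    have hlt := hmono (Fin.castSucc_lt_succ (i := i))
    have h := hδ i.succ i.castSucc (Fin.castSucc_lt_succ (i := i)).ne'
    rw [abs_of_pos (sub_pos.mpr hlt)] at h
    simp only [Fin.val_castSucc, Fin.val_succ]
    push_cast
    linarith
  wlog h : j ≤ p generalizing p j
  · rw [abs_sub_comm, abs_sub_comm (θ p)]
    exact this j p (le_of_not_ge h)
  have h1 := hmono' h
  have h2 : ((j : ℕ) : ℝ) ≤ (p : ℕ) := by exact_mod_cast h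
  rw [abs_of_nonneg (sub_nonneg.mpr h2), abs_of_nonneg (sub_nonneg.mpr (hmono.monotone h))]
  simp only at h1
  linarith

theorem four_pow_mul_factorial_sq_le (m : ℕ) :
    4 ^ (m + 1) * m.factorial ^ 2 ≤ 4 * (2 * m + 2).factorial := by
  induction m with
  | zero => decide
  | succ m ih =>
    have h : (2 * (m + 1) + 2).factorial = (2 * m + 4) * ((2 * m + 3) * (2 * m + 2).factorial) :=
      rfl
    rw [h, Nat.factorial_succ]
    calc _ = 4 * (m + 1) ^ 2 * (4 ^ (m + 1) * m.factorial ^ 2) := by ring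
      _ ≤ ((2 * m + 4) * (2 * m + 3)) * (4 * (2 * m + 2).factorial) :=
        Nat.mul_le_mul (by nlinarith) ih
      _ = _ := by ring

theorem two_mul_four_pow_mul_factorial_le (m : ℕ) :
    2 * 4 ^ (m + 1) * ((m + 1).factorial * m.factorial) ≤ 4 * (2 * m + 3).factorial := by
  induction m with
  | zero => decide
  | succ m ih =>
    have h : (2 * (m + 1) + 3).factorial = (2 * m + 5) * ((2 * m + 4) * (2 * m + 3).factorial) :=
      rfl
    rw [h, Nat.factorial_succ (m + 1), Nat.factorial_succ m] at *
    calc _ = 4 * ((m + 2) * (m + 1)) *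
          (2 * 4 ^ (m + 1) * ((m + 1) * m.factorial * m.factorial)) := by ring
      _ ≤ ((2 * m + 5) * (2 * m + 4)) * (4 * (2 * m + 3).factorial) :=
        Nat.mul_le_mul (by nlinarith) ih
      _ = _ := by ring

theorem two_pow_mul_xiP_le_factorial (k : ℕ) (hk : 1 ≤ k) :
    2 ^ k * xiP k ≤ (k.factorial : ℝ) := by
  unfold xiP
  split_ifs with h1 h2
  · subst h1
    norm_num
  · obtain ⟨m, rfl⟩ : ∃ m, k = 2 * m + 3 := ⟨(k - 3) / 2, by omega⟩
    have h := two_mul_four_pow_mul_factorial_le m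
    rw [show (2 * m + 3 - 1) / 2 = m + 1 by omega, show (2 * m + 3 - 3) / 2 = m by omega]
    have hpow : (2 : ℝ) ^ (2 * m + 3) = 2 * 4 ^ (m + 1) := by
      rw [show 2 * m + 3 = 2 * (m + 1) + 1 by ring, pow_succ, pow_mul]
      norm_num [mul_comm]
    have h' : (2 : ℝ) * 4 ^ (m + 1) * ((m + 1).factorial * m.factorial)
        ≤ 4 * (2 * m + 3).factorial := by exact_mod_cast h
    rw [hpow]
    linarith
  · obtain ⟨m, rfl⟩ : ∃ m, k = 2 * m + 2 := ⟨(k - 2) / 2, by omega⟩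
    have h := four_pow_mul_factorial_sq_le m
    rw [show (2 * m + 2 - 2) / 2 = m by omega]
    have hpow : (2 : ℝ) ^ (2 * m + 2) = 4 ^ (m + 1) := by
      rw [show 2 * m + 2 = 2 * (m + 1) by ring, pow_mul]
      norm_num
    have h' : (4 : ℝ) ^ (m + 1) * m.factorial ^ 2 ≤ 4 * (2 * m + 2).factorial := by
      exact_mod_cast h
    rw [hpow]
    linarith

theorem sum_inv_factorial_mul_factorial (k : ℕ) :
    ∑ j : Fin (k + 1), (((j : ℕ).factorial : ℝ) * ((k - j : ℕ).factorial : ℝ))⁻¹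
      = 2 ^ k / k.factorial := by
  rw [Fin.sum_univ_eq_sum_range
    (fun j : ℕ => ((j.factorial : ℝ) * ((k - j : ℕ).factorial : ℝ))⁻¹) (k + 1)]
  have h : (2 : ℝ) ^ k = ∑ m ∈ range (k + 1), (k.choose m : ℝ) := by
    exact_mod_cast (Nat.sum_range_choose k).symm
  rw [h, sum_div]
  refine sum_congr rfl fun j hj => ?_
  rw [Nat.cast_choose ℝ (Nat.lt_succ_iff.mp (mem_range.mp hj))]
  have := Nat.cast_ne_zero (R := ℝ).mpr k.factorial_ne_zero
  field_simp

theorem sum_prod_sub_div_prod_sub_eq_one (k : ℕ) (θ : Fin (k + 1) → ℝ)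
    (hθ : Function.Injective θ) (z : Fin k → ℝ) :
    ∑ j, (∏ q, (θ j - z q)) / ∏ p ∈ univ.erase j, (θ j - θ p) = 1 := by
  have hmonic : (∏ q : Fin k, (Polynomial.X - Polynomial.C (z q))).Monic :=
    Polynomial.monic_prod_of_monic _ _ fun q _ => Polynomial.monic_X_sub_C _
  have hdeg : (∏ q : Fin k, (Polynomial.X - Polynomial.C (z q))).degree = (k : WithBot ℕ) := by
    simp [Polynomial.degree_prod]
  have h := Lagrange.leadingCoeff_eq_sum (s := univ) (v := θ) hθ.injOn
    (P := ∏ q : Fin k, (Polynomial.X - Polynomial.C (z q))) (by rw [hdeg]; simp)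
  rw [hmonic.leadingCoeff] at h
  simpa [Polynomial.eval_prod] using h.symm

theorem stmt9 (k : ℕ) (hk : 1 ≤ k) (θ : Fin (k + 1) → ℝ)
    (hmono : StrictMono θ)
    (hrange : ∀ j, θ j ∈ Set.Icc (-(π / 2)) (π / 2))
    (θmin : ℝ)
    (hθmin : IsLeast {d : ℝ | ∃ p j, p ≠ j ∧ d = |θ p - θ j|} θmin)
    (θhat : Fin k → ℝ) :
    ∃ j : Fin (k + 1), xiP k * θmin ^ k ≤ ∏ q : Fin k, |θ j - θhat q| := by
  by_contra! hlt
  have hpos : 0 < θmin := by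
    obtain ⟨⟨p, j, hpj, h⟩, -⟩ := hθmin
    rw [h]
    exact abs_pos.mpr (sub_ne_zero.mpr (hmono.injective.ne hpj))
  have hgap := mul_abs_sub_le_abs_sub_of_gap k θ hmono θmin
    fun p j hpj => hθmin.2 ⟨p, j, hpj, rfl⟩
  have hden (j : Fin (k + 1)) :
      θmin ^ k * (((j : ℕ).factorial : ℝ) * ((k - j : ℕ).factorial : ℝ))
        ≤ ∏ p ∈ univ.erase j, |θ j - θ p| := by
    calc _ = ∏ p ∈ univ.erase j, θmin * |((p : ℕ) : ℝ) - (j : ℕ)| := by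
          rw [prod_mul_distrib, prod_erase_abs_sub_eq_factorial_mul]
          simp
      _ ≤ _ := prod_le_prod (fun _ _ => by positivity) fun p _ => by
          rw [abs_sub_comm (θ j)]
          exact hgap p j
  have hterm (j : Fin (k + 1)) :
      |(∏ q, (θ j - θhat q)) / ∏ p ∈ univ.erase j, (θ j - θ p)|
        < xiP k * (((j : ℕ).factorial : ℝ) * ((k - j : ℕ).factorial : ℝ))⁻¹ := by
    rw [abs_div, abs_prod, abs_prod]
    calc _ ≤ (∏ q, |θ j - θhat q|)
          / (θmin ^ k * (((j : ℕ).factorial : ℝ) * ((k - j : ℕ).factorial : ℝ))) :=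
          div_le_div_of_nonneg_left (by positivity) (by positivity) (hden j)
      _ < (xiP k * θmin ^ k)
          / (θmin ^ k * (((j : ℕ).factorial : ℝ) * ((k - j : ℕ).factorial : ℝ))) :=
          div_lt_div_of_pos_right (hlt j) (by positivity)
      _ = _ := by field_simp
  have hsum := sum_prod_sub_div_prod_sub_eq_one k θ hmono.injective θhat
  have hcontra : (1 : ℝ) < 1 := by
    calc (1 : ℝ) = |∑ j, (∏ q, (θ j - θhat q)) / ∏ p ∈ univ.erase j, (θ j - θ p)| := by
          rw [hsum, abs_one]
      _ ≤ ∑ j, |(∏ q, (θ j - θhat q)) / ∏ p ∈ univ.erase j, (θ j - θ p)| :=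
          abs_sum_le_sum_abs _ _
      _ < ∑ j : Fin (k + 1), xiP k * (((j : ℕ).factorial : ℝ) * ((k - j : ℕ).factorial : ℝ))⁻¹ :=
          sum_lt_sum_of_nonempty univ_nonempty fun j _ => hterm j
      _ = 2 ^ k * xiP k / k.factorial := by
          rw [← mul_sum, sum_inv_factorial_mul_factorial]
          ring
      _ ≤ 1 := div_le_one_of_le₀ (two_pow_mul_xiP_le_factorial k hk) (by positivity)
  exact lt_irrefl _ hcontra
end

section
/- Let k ≥ 2, let −π/2 ≤ θ_1 < θ_2 < ⋯ < θ_k ≤ π/2, and let θ̂_1, …, θ̂_k ∈ [−π/2, π/2]. Let ε > 0 and suppose max_{1≤j≤k} ∏_{q=1}^k |θ_j − θ̂_q| < ε and θ_min = min_{q≠j}|θ_q − θ_j| ≥ (4ε/λ(k))^{1/k}, where λ(2) = 1 and λ(k) = ξ(k−2) for k ≥ 3. Then there is a reordering of the θ̂_j's such that |θ̂_j − θ_j| < θ_min/2 for every j, and moreover |θ̂_j − θ_j| ≤ 2^{k−1} ε / ((k−2)! θ_min^{k−1}) for j = 1, …, k. -/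
open scoped Real
open Finset

/-- λ(k) from the paper: λ(2) = 1 and λ(k) = ξ(k−2) for k ≥ 3. -/
noncomputable def lamP (k : ℕ) : ℝ := if k = 2 then 1 else xiP (k - 2)

/-- A product over the indices other than `i` of a weight depending only on the distance to `i`
splits into the part to the left and the part to the right of `i`. -/
lemma prod_erase_weight_dist (n : ℕ) (i : Fin (n + 1)) (w : ℕ → ℝ) :
    ∏ j ∈ univ.erase i, w ((i - j : ℕ) + (j - i : ℕ) - 1) =
      (∏ a ∈ range i, w a) * ∏ b ∈ range (n - i), w b := by
  have hi := i.isLt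
  have h1 : ∏ j ∈ univ.erase i, w ((i - j : ℕ) + (j - i : ℕ) - 1) =
      ∏ j ∈ (range (n + 1)).erase i, w ((i - j : ℕ) + (j - i : ℕ) - 1) := by
    refine prod_bij (fun j _ => (j : ℕ)) ?_ ?_ ?_ ?_
    · intro j hj
      have hne : j ≠ i := (mem_erase.1 hj).1
      simp only [mem_erase, mem_range]
      exact ⟨fun h => hne (Fin.ext h), j.isLt⟩
    · intro a _ b _ h
      exact Fin.ext h
    · intro b hb
      simp only [mem_erase, mem_range] at hb
      exact ⟨⟨b, hb.2⟩, by simp [Fin.ext_iff, hb.1], rfl⟩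
    · intro j _
      rfl
  have h2 : (range (n + 1)).erase (i : ℕ) = range i ∪ Ico ((i : ℕ) + 1) (n + 1) := by
    ext a
    simp only [mem_erase, mem_range, mem_union, mem_Ico]
    omega
  have hd : Disjoint (range (i : ℕ)) (Ico ((i : ℕ) + 1) (n + 1)) := by
    rw [disjoint_left]
    intro a
    simp only [mem_range, mem_Ico]
    omega
  rw [h1, h2, prod_union hd, ← prod_range_reflect w i, prod_Ico_eq_prod_range]
  congr 1
  · refine prod_congr rfl fun a ha => ?_
    have := mem_range.1 ha
    congr 1
    omega
  · rw [show n + 1 - ((i : ℕ) + 1) = n - i by omega]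
    refine prod_congr rfl fun a _ => ?_
    congr 1
    omega

/-- Points on a line with consecutive gaps at least one. -/
lemma sub_le_sub_of_one_le_gap {n : ℕ} {x : Fin n → ℝ} (hx : StrictMono x)
    (hgap : ∀ p q, p ≠ q → 1 ≤ |x p - x q|) {i j : Fin n} (hij : i ≤ j) :
    ((j : ℕ) : ℝ) - (i : ℕ) ≤ x j - x i := by
  obtain ⟨j, hj⟩ := j
  induction j with
  | zero =>
    have : i = ⟨0, hj⟩ := Fin.ext (by simpa [Fin.le_def] using hij)
    simp [this]
  | succ j ih =>
    rcases eq_or_lt_of_le hij with h | h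
    · simp [h]
    · have hj' : j < n := by omega
      have h1 := ih hj' (by simp only [Fin.le_def, Fin.lt_def] at *; omega)
      have hlt : x ⟨j, hj'⟩ < x ⟨j + 1, hj⟩ := hx (by simp [Fin.lt_def])
      have h2 := hgap ⟨j + 1, hj⟩ ⟨j, hj'⟩ (by simp)
      rw [abs_of_pos (by linarith)] at h2
      push_cast at h1 ⊢
      linarith

lemma weight_dist_le_abs_sub {n : ℕ} {x : Fin n → ℝ} (hx : StrictMono x)
    (hgap : ∀ p q, p ≠ q → 1 ≤ |x p - x q|) {i j : Fin n} (hij : i ≠ j) :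
    (((i - j : ℕ) + (j - i : ℕ) - 1 : ℕ) : ℝ) + 1 ≤ |x i - x j| := by
  rcases lt_or_gt_of_ne hij with h | h
  · have h1 := sub_le_sub_of_one_le_gap hx hgap h.le
    have h2 := neg_le_abs (x i - x j)
    have h3 : (i : ℕ) < j := h
    have h4 : ((i - j : ℕ) + (j - i : ℕ) - 1 : ℕ) + 1 + (i : ℕ) = j := by omega
    have h5 : (((i - j : ℕ) + (j - i : ℕ) - 1 : ℕ) : ℝ) + 1 + (i : ℕ) = (j : ℕ) := by
      exact_mod_cast h4
    linarith
  · have h1 := sub_le_sub_of_one_le_gap hx hgap h.le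
    have h2 := le_abs_self (x i - x j)
    have h3 : (j : ℕ) < i := h
    have h4 : ((i - j : ℕ) + (j - i : ℕ) - 1 : ℕ) + 1 + (j : ℕ) = i := by omega
    have h5 : (((i - j : ℕ) + (j - i : ℕ) - 1 : ℕ) : ℝ) + 1 + (j : ℕ) = (i : ℕ) := by
      exact_mod_cast h4
    linarith

lemma factorial_mul_factorial_le_prod_abs_sub {n : ℕ} {x : Fin (n + 1) → ℝ} (hx : StrictMono x)
    (hgap : ∀ p q, p ≠ q → 1 ≤ |x p - x q|) (i : Fin (n + 1)) :
    ((i : ℕ).factorial : ℝ) * (n - i : ℕ).factorial ≤ ∏ j ∈ univ.erase i, |x i - x j| := by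
  have h := prod_erase_weight_dist n i (fun a => (a : ℝ) + 1)
  have hf : ∀ m : ℕ, ∏ a ∈ range m, ((a : ℝ) + 1) = m.factorial := fun m => by
    exact_mod_cast prod_range_add_one_eq_factorial m
  rw [hf, hf] at h
  rw [← h]
  refine prod_le_prod (fun j _ => by positivity) fun j hj => ?_
  exact weight_dist_le_abs_sub hx hgap (mem_erase.1 hj).1.symm

/-- A monic real polynomial of degree `n` is at least `n! / 2 ^ n` in absolute value at one of any
`n + 1` points with mutual distances at least one. -/
lemma exists_factorial_div_two_pow_le_abs_eval {n : ℕ} {x : Fin (n + 1) → ℝ} (hx : StrictMono x)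
    (hgap : ∀ p q, p ≠ q → 1 ≤ |x p - x q|) {P : Polynomial ℝ} (hP : P.Monic)
    (hdeg : P.natDegree = n) :
    ∃ i, (n.factorial : ℝ) / 2 ^ n ≤ |P.eval (x i)| := by
  by_contra! hcon
  have hlead := Lagrange.leadingCoeff_eq_sum (s := univ) (v := x) hx.injective.injOn (P := P)
    (by rw [Polynomial.degree_eq_natDegree hP.ne_zero, hdeg]; simp)
  rw [hP.leadingCoeff] at hlead
  have hterm : ∀ i ∈ (univ : Finset (Fin (n + 1))),
      P.eval (x i) / ∏ j ∈ univ.erase i, (x i - x j) < ((n.choose i : ℕ) : ℝ) / 2 ^ n := by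
    intro i _
    have hf : (0 : ℝ) < ((i : ℕ).factorial : ℝ) * (n - i : ℕ).factorial := by positivity
    have hle := factorial_mul_factorial_le_prod_abs_sub hx hgap i
    calc P.eval (x i) / ∏ j ∈ univ.erase i, (x i - x j)
        ≤ |P.eval (x i)| / ∏ j ∈ univ.erase i, |x i - x j| := by
          rw [← abs_prod, ← abs_div]
          exact le_abs_self _
      _ ≤ |P.eval (x i)| / (((i : ℕ).factorial : ℝ) * (n - i : ℕ).factorial) := by gcongr
      _ < ((n.factorial : ℝ) / 2 ^ n) / (((i : ℕ).factorial : ℝ) * (n - i : ℕ).factorial) := by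
          gcongr
          exact hcon i
      _ = ((n.choose i : ℕ) : ℝ) / 2 ^ n := by
          rw [Nat.cast_choose ℝ (Nat.lt_succ_iff.1 i.isLt)]
          field_simp
  have hsum := sum_lt_sum_of_nonempty univ_nonempty hterm
  rw [← hlead, ← sum_div,
    Fin.sum_univ_eq_sum_range (fun i => ((n.choose i : ℕ) : ℝ)) (n + 1)] at hsum
  have h2 : ∑ i ∈ range (n + 1), ((n.choose i : ℕ) : ℝ) = 2 ^ n := by
    exact_mod_cast Nat.sum_range_choose n
  rw [h2, div_self (by positivity)] at hsum
  exact lt_irrefl _ hsum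

lemma xiP_succ_succ_le {n : ℕ} (hn : 1 ≤ n) :
    xiP (n + 2) ≤ ((n + 2 : ℕ) : ℝ) * (n + 1 : ℕ) / 4 * xiP n := by
  rcases Nat.even_or_odd' n with ⟨m, rfl | rfl⟩
  · obtain ⟨m, rfl⟩ : ∃ l, m = l + 1 := ⟨m - 1, by omega⟩
    have h1 : xiP (2 * (m + 1) + 2) = ((m + 1).factorial : ℝ) ^ 2 / 4 := by
      unfold xiP
      rw [if_neg (by omega), if_neg (by omega), show (2 * (m + 1) + 2 - 2) / 2 = m + 1 by omega]
    have h2 : xiP (2 * (m + 1)) = (m.factorial : ℝ) ^ 2 / 4 := by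
      unfold xiP
      rw [if_neg (by omega), if_neg (by omega), show (2 * (m + 1) - 2) / 2 = m by omega]
    rw [h1, h2, Nat.factorial_succ]
    push_cast
    have : (0 : ℝ) ≤ (m.factorial : ℝ) ^ 2 := by positivity
    have hm : (0 : ℝ) ≤ m := by positivity
    nlinarith [mul_nonneg this hm, mul_nonneg (mul_nonneg this hm) hm]
  · rcases m with _ | m
    · norm_num [xiP, Nat.factorial]
    · have h1 : xiP (2 * (m + 1) + 1 + 2) =
          ((m + 2).factorial : ℝ) * (m + 1).factorial / 4 := by
        unfold xiP
        rw [if_neg (by omega), if_pos (by omega),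
          show (2 * (m + 1) + 1 + 2 - 1) / 2 = m + 2 by omega,
          show (2 * (m + 1) + 1 + 2 - 3) / 2 = m + 1 by omega]
      have h2 : xiP (2 * (m + 1) + 1) = ((m + 1).factorial : ℝ) * m.factorial / 4 := by
        unfold xiP
        rw [if_neg (by omega), if_pos (by omega),
          show (2 * (m + 1) + 1 - 1) / 2 = m + 1 by omega,
          show (2 * (m + 1) + 1 - 3) / 2 = m by omega]
      rw [h1, h2, Nat.factorial_succ (m + 1), Nat.factorial_succ m]
      push_cast
      have : (0 : ℝ) ≤ (m.factorial : ℝ) ^ 2 := by positivity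
      have hm : (0 : ℝ) ≤ m := by positivity
      nlinarith [mul_nonneg this hm, mul_nonneg (mul_nonneg this hm) hm,
        mul_nonneg (mul_nonneg (mul_nonneg this hm) hm) hm]

lemma xiP_le_factorial_div_two_pow : ∀ n : ℕ, 1 ≤ n → xiP n ≤ (n.factorial : ℝ) / 2 ^ n
  | 0, h => by omega
  | 1, _ => by norm_num [xiP]
  | 2, _ => by norm_num [xiP, Nat.factorial]
  | n + 3, _ => by
    have h1 := xiP_succ_succ_le (n := n + 1) (by omega)
    have h2 := xiP_le_factorial_div_two_pow (n + 1) (by omega)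
    refine h1.trans ((mul_le_mul_of_nonneg_left h2 (by positivity)).trans_eq ?_)
    rw [Nat.factorial_succ (n + 2), Nat.factorial_succ (n + 1), pow_succ 2 (n + 2),
      pow_succ 2 (n + 1)]
    push_cast
    field_simp
    ring

lemma lamP_le_factorial_div_two_pow (n : ℕ) : lamP (n + 2) ≤ (n.factorial : ℝ) / 2 ^ n := by
  unfold lamP
  rcases n with _ | n
  · simp
  · rw [if_neg (by omega), Nat.add_sub_cancel]
    exact xiP_le_factorial_div_two_pow _ (by omega)

lemma lamP_pos {k : ℕ} : 0 < lamP k := by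
  unfold lamP xiP
  split_ifs <;> positivity

lemma factorial_div_two_pow_le_prod_mul_prod (N : ℕ) : ∀ n m : ℕ, n + m = N + 1 →
    (N.factorial : ℝ) / 2 ^ (N + 1) ≤
      (∏ a ∈ range n, ((a : ℝ) + 1 / 2)) * ∏ b ∈ range m, ((b : ℝ) + 1 / 2) := by
  induction N with
  | zero =>
    intro n m h
    obtain ⟨rfl, rfl⟩ | ⟨rfl, rfl⟩ : n = 0 ∧ m = 1 ∨ n = 1 ∧ m = 0 := by omega
    all_goals norm_num
  | succ N ih =>
    have key : ∀ n m : ℕ, m ≤ n → n + m = N + 1 + 1 →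
        ((N + 1).factorial : ℝ) / 2 ^ (N + 1 + 1) ≤
          (∏ a ∈ range n, ((a : ℝ) + 1 / 2)) * ∏ b ∈ range m, ((b : ℝ) + 1 / 2) := by
      intro n m hmn h
      obtain ⟨n, rfl⟩ : ∃ l, n = l + 1 := ⟨n - 1, by omega⟩
      have h1 := ih n m (by omega)
      have h2 : ((N : ℝ) + 1) / 2 ≤ (n : ℝ) + 1 / 2 := by
        have : N + 1 ≤ 2 * n + 1 := by omega
        have : (N : ℝ) + 1 ≤ 2 * n + 1 := by exact_mod_cast this
        linarith
      calc ((N + 1).factorial : ℝ) / 2 ^ (N + 1 + 1)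
          = ((N : ℝ) + 1) / 2 * ((N.factorial : ℝ) / 2 ^ (N + 1)) := by
            rw [Nat.factorial_succ, pow_succ 2 (N + 1)]
            push_cast
            field_simp
        _ ≤ ((n : ℝ) + 1 / 2) *
            ((∏ a ∈ range n, ((a : ℝ) + 1 / 2)) * ∏ b ∈ range m, ((b : ℝ) + 1 / 2)) := by
            gcongr
        _ = _ := by
            rw [prod_range_succ]
            ring
    intro n m h
    rcases le_total m n with hmn | hmn
    · exact key n m hmn h
    · rw [mul_comm]
      exact key m n hmn (by omega)

/-- A relation from a finite type to itself, functional in the first argument, either contains the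
inverse graph of a permutation, or there are two points related to at most one common point. -/
lemma exists_perm_or_exists_pair {k : ℕ} (hk : 2 ≤ k) (r : Fin k → Fin k → Prop)
    (hr : ∀ q i j, r q i → r q j → i = j) :
    (∃ e : Equiv.Perm (Fin k), ∀ j, r (e j) j) ∨
      ∃ p₁ p₂ j, p₁ ≠ p₂ ∧ ∀ i, i ≠ j → ¬ r p₁ i ∧ ¬ r p₂ i := by
  classical
  by_cases hall : ∀ j, ∃ q, r q j
  · left
    choose g hg using hall
    have hinj : Function.Injective g := fun a b hab => hr (g a) a b (hg a) (hab ▸ hg b)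
    exact ⟨Equiv.ofBijective g (Finite.injective_iff_bijective.1 hinj), hg⟩
  · right
    push Not at hall
    obtain ⟨j₀, hj₀⟩ := hall
    have hf : ∀ q, ∃ j, ∀ i, r q i → i = j := fun q => by
      by_cases h : ∃ j, r q j
      · obtain ⟨j, hj⟩ := h
        exact ⟨j, fun i hi => hr q i j hi hj⟩
      · exact ⟨j₀, fun i hi => (h ⟨i, hi⟩).elim⟩
    choose f hf using hf
    by_cases hinj : Function.Injective f
    · obtain ⟨p₁, hp₁⟩ := (Finite.injective_iff_surjective.1 hinj) j₀
      have : Nontrivial (Fin k) := Fin.nontrivial_iff_two_le.2 hk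
      obtain ⟨p₂, hp₂⟩ := exists_ne p₁
      refine ⟨p₁, p₂, f p₂, hp₂.symm, fun i hi => ⟨fun h => ?_, fun h => hi (hf p₂ i h)⟩⟩
      have := (hf p₁ i h).trans hp₁
      exact hj₀ p₁ (this ▸ h)
    · simp only [Function.Injective, not_forall] at hinj
      obtain ⟨p₁, p₂, heq, hne⟩ := hinj
      exact ⟨p₁, p₂, f p₁, hne, fun i hi =>
        ⟨fun h => hi (hf p₁ i h), fun h => hi ((hf p₂ i h).trans heq.symm)⟩⟩

/-- If no point other than the `j`-th lies within distance `1 / 2` of `y p₁` or `y p₂`, then one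
of the products of distances is large. -/
lemma exists_le_prod_abs_sub_of_pair {n : ℕ} {x y : Fin (n + 2) → ℝ} (hx : StrictMono x)
    (hgap : ∀ p q, p ≠ q → 1 ≤ |x p - x q|) {p₁ p₂ j : Fin (n + 2)} (hp : p₁ ≠ p₂)
    (hfar : ∀ i, i ≠ j → 1 / 2 ≤ |x i - y p₁| ∧ 1 / 2 ≤ |x i - y p₂|) :
    ∃ i, (n.factorial : ℝ) / 2 ^ n / 4 ≤ ∏ q, |x i - y q| := by
  set S : Finset (Fin (n + 2)) := (univ.erase p₁).erase p₂ with hS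
  have hmem : p₂ ∈ univ.erase p₁ := mem_erase.2 ⟨hp.symm, mem_univ _⟩
  have hcard : #S = n := by
    rw [hS, card_erase_of_mem hmem, card_erase_of_mem (mem_univ _)]
    simp
  obtain ⟨i, hi⟩ := exists_factorial_div_two_pow_le_abs_eval (x := x ∘ j.succAbove)
    (hx.comp (Fin.strictMono_succAbove j))
    (fun p q hpq => hgap _ _ fun h => hpq (Fin.succAbove_right_injective h))
    (Lagrange.nodal_monic (s := S) (v := y))
    (by rw [Lagrange.natDegree_nodal, hcard])
  rw [Lagrange.eval_nodal, abs_prod] at hi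
  refine ⟨j.succAbove i, ?_⟩
  obtain ⟨h1, h2⟩ := hfar (j.succAbove i) (Fin.succAbove_ne j i)
  rw [← mul_prod_erase univ _ (mem_univ p₁), ← mul_prod_erase _ _ hmem, ← mul_assoc]
  have h3 : (1 : ℝ) / 2 * (1 / 2) ≤ |x (j.succAbove i) - y p₁| * |x (j.succAbove i) - y p₂| := by
    gcongr
  calc (n.factorial : ℝ) / 2 ^ n / 4 = 1 / 2 * (1 / 2) * ((n.factorial : ℝ) / 2 ^ n) := by ring
    _ ≤ _ := mul_le_mul h3 hi (by positivity) (by positivity)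

lemma factorial_div_two_pow_le_prod_erase_abs_sub {n : ℕ} {x z : Fin (n + 2) → ℝ}
    (hx : StrictMono x) (hgap : ∀ p q, p ≠ q → 1 ≤ |x p - x q|)
    (hz : ∀ i, |z i - x i| < 1 / 2) (j : Fin (n + 2)) :
    (n.factorial : ℝ) / 2 ^ (n + 1) ≤ ∏ i ∈ univ.erase j, |x j - z i| := by
  have hj := j.isLt
  refine (factorial_div_two_pow_le_prod_mul_prod n j (n + 1 - j) (by omega)).trans ?_
  rw [← prod_erase_weight_dist (n + 1) j (fun a => (a : ℝ) + 1 / 2)]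
  refine prod_le_prod (fun i _ => by positivity) fun i hi => ?_
  have h1 := weight_dist_le_abs_sub hx hgap (mem_erase.1 hi).1.symm
  have h2 := abs_sub_le (x j) (z i) (x i)
  have h3 := hz i
  linarith

/-- The matching statement for points normalised to have mutual distances at least one. -/
lemma exists_perm_abs_sub_le_of_one_le_gap {n : ℕ} {x y : Fin (n + 2) → ℝ} (hx : StrictMono x)
    (hgap : ∀ p q, p ≠ q → 1 ≤ |x p - x q|) {δ : ℝ} (hδ : 4 * δ ≤ lamP (n + 2))
    (hprod : ∀ j, ∏ q, |x j - y q| < δ) :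
    ∃ e : Equiv.Perm (Fin (n + 2)), ∀ j,
      |y (e j) - x j| < 1 / 2 ∧ |y (e j) - x j| ≤ 2 ^ (n + 1) * δ / n.factorial := by
  rcases exists_perm_or_exists_pair (by omega) (fun q i => |y q - x i| < 1 / 2) (by
    intro q i j hi hj
    by_contra hne
    have h1 := hgap i j hne
    have h2 := abs_sub_le (x i) (y q) (x j)
    rw [abs_sub_comm (x i) (y q)] at h2
    linarith) with ⟨e, he⟩ | ⟨p₁, p₂, j, hp, hfar⟩
  · refine ⟨e, fun j => ⟨he j, ?_⟩⟩
    have h1 := hprod j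
    rw [← Equiv.prod_comp e, ← mul_prod_erase univ _ (mem_univ j), abs_sub_comm] at h1
    have h2 := factorial_div_two_pow_le_prod_erase_abs_sub hx hgap he j
    have h3 : |y (e j) - x j| * ((n.factorial : ℝ) / 2 ^ (n + 1)) ≤ δ :=
      (mul_le_mul_of_nonneg_left h2 (abs_nonneg _)).trans h1.le
    rw [mul_div_assoc', div_le_iff₀ (by positivity)] at h3
    rw [le_div_iff₀ (by positivity), mul_comm _ δ]
    exact h3
  · obtain ⟨i, hi⟩ := exists_le_prod_abs_sub_of_pair (y := y) hx hgap hp (fun i hi => by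
      have := hfar i hi
      rwa [not_lt, not_lt, abs_sub_comm, abs_sub_comm (y p₂)] at this)
    have h1 := hprod i
    have h2 := lamP_le_factorial_div_two_pow n
    linarith

theorem stmt11 (k : ℕ) (hk : 2 ≤ k) (θ θhat : Fin k → ℝ)
    (hmono : StrictMono θ)
    (hrange : ∀ j, θ j ∈ Set.Icc (-(π / 2)) (π / 2))
    (hrangehat : ∀ j, θhat j ∈ Set.Icc (-(π / 2)) (π / 2))
    (ε : ℝ) (hε : 0 < ε)
    (hprod : ∀ j : Fin k, ∏ q : Fin k, |θ j - θhat q| < ε)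
    (θmin : ℝ)
    (hθmin : IsLeast {d : ℝ | ∃ p j, p ≠ j ∧ d = |θ p - θ j|} θmin)
    (hsep : (4 * ε / lamP k) ^ ((1 : ℝ) / k) ≤ θmin) :
    ∃ e : Equiv.Perm (Fin k), ∀ j : Fin k,
      |θhat (e j) - θ j| < θmin / 2 ∧
      |θhat (e j) - θ j| ≤ 2 ^ (k - 1) * ε / ((Nat.factorial (k - 2) : ℝ) * θmin ^ (k - 1)) := by
  obtain ⟨n, rfl⟩ : ∃ n, k = n + 2 := ⟨k - 2, by omega⟩
  have hd : 0 < θmin := by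
    obtain ⟨p, j, hpj, h⟩ := hθmin.1
    rw [h]
    exact abs_pos.2 (sub_ne_zero.2 (hmono.injective.ne hpj))
  have hpow : 4 * ε / lamP (n + 2) ≤ θmin ^ (n + 2) := by
    have h0 : 0 ≤ 4 * ε / lamP (n + 2) := (div_pos (by positivity) lamP_pos).le
    have h1 := pow_le_pow_left₀ (Real.rpow_nonneg h0 _) hsep (n + 2)
    rwa [one_div, Real.rpow_inv_natCast_pow h0 (by omega)] at h1
  have hdist : ∀ a b : ℝ, |a / θmin - b / θmin| = |a - b| / θmin := fun a b => by
    rw [← sub_div, abs_div, abs_of_pos hd]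
  obtain ⟨e, he⟩ := exists_perm_abs_sub_le_of_one_le_gap
    (x := fun j => θ j / θmin) (y := fun j => θhat j / θmin) (δ := ε / θmin ^ (n + 2))
    (fun a b hab => div_lt_div_of_pos_right (hmono hab) hd)
    (fun p q hpq => by
      rw [hdist, one_le_div hd]
      exact hθmin.2 ⟨p, q, hpq, rfl⟩)
    (by
      rw [div_le_iff₀ lamP_pos] at hpow
      rw [← mul_div_assoc, div_le_iff₀ (by positivity)]
      linarith)
    (fun j => by
      simp only [hdist]
      rw [prod_div_distrib, prod_const, card_univ, Fintype.card_fin]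
      exact div_lt_div_of_pos_right (hprod j) (by positivity))
  refine ⟨e, fun j => ?_⟩
  obtain ⟨h1, h2⟩ := he j
  rw [hdist] at h1 h2
  constructor
  · rw [div_lt_iff₀ hd] at h1
    linarith
  · rw [div_le_iff₀ hd] at h2
    refine h2.trans_eq ?_
    rw [show n + 2 - 1 = n + 1 by omega, show n + 2 - 2 = n by omega, pow_succ θmin (n + 1)]
    field_simp
end

section
/- For every integer n ≥ 2, ( 2√(2n−1) / (ζ(n) ξ(n−1)) )^{1/(2n−2)} ≤ 4.4 e / (2n−1), where ζ(n) = (((n−1)/2)!)² if n is odd, ζ(n) = (n/2)!((n−2)/2)! if n is even, ξ(1) = 1/2, ξ(k) = ((k−1)/2)!((k−3)/2)!/4 for odd k ≥ 3, and ξ(k) = (((k−2)/2)!)²/4 for even k. -/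
open scoped Real

/-- ζ(k) from the paper: ζ(k) = (((k−1)/2)!)² for odd k, (k/2)!((k−2)/2)! for even k. -/
noncomputable def zetaP (k : ℕ) : ℝ :=
  if k % 2 = 1 then ((Nat.factorial ((k - 1) / 2) : ℝ)) ^ 2
  else (Nat.factorial (k / 2) : ℝ) * (Nat.factorial ((k - 2) / 2) : ℝ)

theorem zetaP_pos (n : ℕ) : 0 < zetaP n := by
  unfold zetaP
  split_ifs <;> positivity

theorem xiP_pos (n : ℕ) : 0 < xiP n := by
  unfold xiP
  split_ifs <;> positivity

theorem zetaP_odd (m : ℕ) : zetaP (2 * m + 1) = (m.factorial : ℝ) ^ 2 := by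
  rw [zetaP, if_pos (by omega), show (2 * m + 1 - 1) / 2 = m by omega]

theorem zetaP_even (m : ℕ) :
    zetaP (2 * m + 2) = ((m + 1).factorial : ℝ) * (m.factorial : ℝ) := by
  rw [zetaP, if_neg (by omega), show (2 * m + 2) / 2 = m + 1 by omega,
    show (2 * m + 2 - 2) / 2 = m by omega]

theorem xiP_odd (m : ℕ) :
    xiP (2 * m + 3) = ((m + 1).factorial : ℝ) * (m.factorial : ℝ) / 4 := by
  rw [xiP, if_neg (by omega), if_pos (by omega), show (2 * m + 3 - 1) / 2 = m + 1 by omega,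
    show (2 * m + 3 - 3) / 2 = m by omega]

theorem xiP_even (m : ℕ) : xiP (2 * m + 2) = (m.factorial : ℝ) ^ 2 / 4 := by
  rw [xiP, if_neg (by omega), if_neg (by omega), show (2 * m + 2 - 2) / 2 = m by omega]

/-- Growth of the product `ζ(n) ξ(n - 1)` under `n ↦ n + 2`, with `n = k + 2`. -/
theorem zetaP_mul_xiP_growth {k : ℕ} (hk : 1 ≤ k) :
    zetaP (k + 2) * xiP (k + 1) * (((k : ℝ) + 2) ^ 2 * (k * (k + 4)) / 16)
      ≤ zetaP (k + 4) * xiP (k + 3) := by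
  rcases Nat.even_or_odd' k with ⟨j, rfl | rfl⟩
  · obtain ⟨i, rfl⟩ : ∃ i, j = i + 1 := ⟨j - 1, by omega⟩
    have h₁ := zetaP_even (i + 1)
    have h₂ := zetaP_even (i + 2)
    have h₃ := xiP_odd i
    have h₄ := xiP_odd (i + 1)
    rw [show 2 * (i + 1) + 1 = 2 * i + 3 by ring, h₁, h₃,
      show 2 * (i + 1) + 4 = 2 * (i + 2) + 2 by ring, h₂, h₄]
    simp only [Nat.factorial_succ]
    push_cast
    apply le_of_eq
    ring
  · have h₁ := zetaP_odd (j + 1)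
    have h₂ := zetaP_odd (j + 2)
    have h₃ := xiP_even j
    have h₄ := xiP_even (j + 1)
    rw [show 2 * j + 1 + 2 = 2 * (j + 1) + 1 by ring, h₁,
      show 2 * j + 1 + 1 = 2 * j + 2 by ring, h₃,
      show 2 * j + 1 + 4 = 2 * (j + 2) + 1 by ring, h₂,
      show 2 * j + 1 + 3 = 2 * (j + 1) + 2 by ring, h₄]
    simp only [Nat.factorial_succ]
    push_cast
    have hf : (0 : ℝ) ≤ ((j + 1) * (j.factorial : ℝ)) ^ 2 * (j.factorial : ℝ) ^ 2 := by positivity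
    have hj : ((2 * (j : ℝ) + 1 + 2) ^ 2 * ((2 * j + 1) * (2 * j + 1 + 4)) / 16) / 4
        ≤ ((j + 2) * (j + 1)) ^ 2 / 4 := by nlinarith [sq_nonneg (j : ℝ), j.cast_nonneg (α := ℝ)]
    have := mul_le_mul_of_nonneg_left hj hf
    nlinarith [this]

theorem pow_shift_le_exp_mul (k : ℕ) :
    (2 * (k : ℝ) + 7) ^ (4 * k + 5) ≤ Real.exp 1 ^ 8 * (2 * (k : ℝ) + 3) ^ (4 * k + 5) := by
  have hs : (0 : ℝ) < 2 * k + 3 := by positivity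
  have h₁ : 2 * (k : ℝ) + 7 ≤ Real.exp (4 / (2 * k + 3)) * (2 * k + 3) := by
    have h := mul_le_mul_of_nonneg_right (Real.add_one_le_exp (4 / (2 * (k : ℝ) + 3))) hs.le
    have h' : (4 / (2 * (k : ℝ) + 3) + 1) * (2 * k + 3) = 2 * k + 7 := by field_simp; ring
    linarith
  have h₂ : Real.exp (4 / (2 * (k : ℝ) + 3)) ^ (4 * k + 5) ≤ Real.exp 1 ^ 8 := by
    rw [← Real.exp_nat_mul, ← Real.exp_nat_mul, Real.exp_le_exp, ← mul_div_assoc,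
      div_le_iff₀ hs]
    push_cast
    linarith
  calc (2 * (k : ℝ) + 7) ^ (4 * k + 5)
      ≤ (Real.exp (4 / (2 * k + 3)) * (2 * k + 3)) ^ (4 * k + 5) := by gcongr
    _ = Real.exp (4 / (2 * k + 3)) ^ (4 * k + 5) * (2 * (k : ℝ) + 3) ^ (4 * k + 5) := mul_pow ..
    _ ≤ _ := by gcongr

theorem pow_le_growth_factor {k : ℕ} (hk : 14 ≤ k) :
    (2 * (k : ℝ) + 7) ^ 4 ≤ 4.4 ^ 4 * (((k : ℝ) + 2) ^ 2 * (k * (k + 4)) / 16) := by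
  obtain ⟨i, rfl⟩ := Nat.exists_eq_add_of_le hk
  push_cast
  rw [← sub_nonneg]
  ring_nf
  positivity

/-- Squared form of the estimate, for `n = k + 2`, free of roots. -/
theorem pow_le_mul_zetaP_mul_xiP_sq (k : ℕ) :
    4 * (2 * (k : ℝ) + 3) ^ (4 * k + 5)
      ≤ (4.4 * Real.exp 1) ^ (4 * k + 4) * (zetaP (k + 2) * xiP (k + 1)) ^ 2 := by
  induction k using Nat.strong_induction_on with
  | _ k ih =>
    rcases lt_or_ge k 16 with hk | hk
    · have he : (2.718 : ℝ) ≤ Real.exp 1 := by linarith [Real.exp_one_gt_d9]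
      calc 4 * (2 * (k : ℝ) + 3) ^ (4 * k + 5)
          ≤ (4.4 * 2.718) ^ (4 * k + 4) * (zetaP (k + 2) * xiP (k + 1)) ^ 2 := by
            clear ih
            interval_cases k <;> norm_num [zetaP, xiP, Nat.factorial]
        _ ≤ _ := by gcongr
    · obtain ⟨k, rfl⟩ : ∃ j, k = j + 2 := ⟨k - 2, by omega⟩
      have ih := ih k (by omega)
      have hP := mul_pos (zetaP_pos (k + 2)) (xiP_pos (k + 1))
      have hg := zetaP_mul_xiP_growth (k := k) (by omega)
      have hf := pow_le_growth_factor (k := k) (by omega)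
      have hp := pow_shift_le_exp_mul k
      set P := zetaP (k + 2) * xiP (k + 1)
      set g := ((k : ℝ) + 2) ^ 2 * (k * (k + 4)) / 16
      have hg0 : 0 ≤ g := by positivity
      calc 4 * (2 * ((k + 2 : ℕ) : ℝ) + 3) ^ (4 * (k + 2) + 5)
          = 4 * ((2 * (k : ℝ) + 7) ^ 4) ^ 2 * (2 * (k : ℝ) + 7) ^ (4 * k + 5) := by
            push_cast
            ring
        _ ≤ 4 * (4.4 ^ 4 * g) ^ 2 * (Real.exp 1 ^ 8 * (2 * (k : ℝ) + 3) ^ (4 * k + 5)) := by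
            gcongr
        _ = (4.4 * Real.exp 1) ^ 8 * g ^ 2 * (4 * (2 * (k : ℝ) + 3) ^ (4 * k + 5)) := by ring
        _ ≤ (4.4 * Real.exp 1) ^ 8 * g ^ 2 * ((4.4 * Real.exp 1) ^ (4 * k + 4) * P ^ 2) := by
            gcongr
        _ = (4.4 * Real.exp 1) ^ (4 * (k + 2) + 4) * (P * g) ^ 2 := by ring
        _ ≤ (4.4 * Real.exp 1) ^ (4 * (k + 2) + 4) * (zetaP (k + 4) * xiP (k + 3)) ^ 2 := by
            gcongr

theorem stmt18 (n : ℕ) (hn : 2 ≤ n) :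
    (2 * Real.sqrt (2 * (n : ℝ) - 1) / (zetaP n * xiP (n - 1))) ^ ((1 : ℝ) / (2 * (n : ℝ) - 2))
      ≤ 4.4 * Real.exp 1 / (2 * (n : ℝ) - 1) := by
  obtain ⟨k, rfl⟩ : ∃ k, n = k + 2 := ⟨n - 2, by omega⟩
  have hP := mul_pos (zetaP_pos (k + 2)) (xiP_pos (k + 1))
  have hs : (0 : ℝ) < 2 * k + 3 := by positivity
  have key := pow_le_mul_zetaP_mul_xiP_sq k
  rw [show k + 2 - 1 = k + 1 by omega,
    show 2 * ((k + 2 : ℕ) : ℝ) - 1 = 2 * k + 3 by push_cast; ring,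
    show 2 * ((k + 2 : ℕ) : ℝ) - 2 = ((2 * k + 2 : ℕ) : ℝ) by push_cast; ring, one_div]
  set P := zetaP (k + 2) * xiP (k + 1)
  have hle : 2 * √(2 * (k : ℝ) + 3) / P ≤ (4.4 * Real.exp 1 / (2 * k + 3)) ^ (2 * k + 2) := by
    rw [div_pow, div_le_div_iff₀ hP (by positivity)]
    refine (sq_le_sq₀ (by positivity) (by positivity)).mp ?_
    calc (2 * √(2 * (k : ℝ) + 3) * (2 * k + 3) ^ (2 * k + 2)) ^ 2
        = 4 * √(2 * (k : ℝ) + 3) ^ 2 * (2 * (k : ℝ) + 3) ^ (4 * k + 4) := by ring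
      _ = 4 * (2 * (k : ℝ) + 3) ^ (4 * k + 5) := by rw [Real.sq_sqrt hs.le]; ring
      _ ≤ _ := key
      _ = _ := by ring
  calc _ ≤ ((4.4 * Real.exp 1 / (2 * (k : ℝ) + 3)) ^ (2 * k + 2)) ^ (((2 * k + 2 : ℕ) : ℝ)⁻¹) := by
        gcongr
    _ = _ := Real.pow_rpow_inv_natCast (by positivity) (by omega)
end

section
/- For every integer n ≥ 2, ( 8√(2n) / (ζ(n) λ(n)) )^{1/(2n−1)} ≤ 5.88 e / (2n), where ζ(n) = (((n−1)/2)!)² if n is odd, ζ(n) = (n/2)!((n−2)/2)! if n is even, λ(2) = 1, λ(n) = ξ(n−2) for n ≥ 3, ξ(1) = 1/2, ξ(k) = ((k−1)/2)!((k−3)/2)!/4 for odd k ≥ 3, and ξ(k) = (((k−2)/2)!)²/4 for even k. -/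
open scoped Real

/-- The denominator-free form of the inequality, for a real `g` in place of `ζ(n) λ(n)`. -/
def DenominatorFreeBound (n : ℕ) (g : ℝ) : Prop :=
  8 * √(2 * (n : ℝ)) * (2 * (n : ℝ)) ^ (2 * n - 1) ≤ (5.88 * Real.exp 1) ^ (2 * n - 1) * g

lemma zetaP_mul_lamP_pos (n : ℕ) : 0 < zetaP n * lamP n := by
  unfold zetaP lamP xiP
  split_ifs <;> positivity

lemma zetaP_mul_lamP_even (m : ℕ) :
    zetaP (2 * m + 4) * lamP (2 * m + 4) =
      ((m + 2).factorial : ℝ) * (m + 1).factorial * (m.factorial : ℝ) ^ 2 / 4 := by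
  have h₁ : ¬ (2 * m + 4) % 2 = 1 := by lia
  have h₂ : ¬ 2 * m + 4 = 2 := by lia
  have h₃ : ¬ 2 * m + 4 - 2 = 1 := by lia
  have h₄ : ¬ (2 * m + 4 - 2) % 2 = 1 := by lia
  rw [zetaP, lamP, xiP, if_neg h₁, if_neg h₂, if_neg h₃, if_neg h₄,
    show (2 * m + 4) / 2 = m + 2 by lia, show (2 * m + 4 - 2) / 2 = m + 1 by lia,
    show (2 * m + 4 - 2 - 2) / 2 = m by lia]
  ring

lemma zetaP_mul_lamP_odd (m : ℕ) :
    zetaP (2 * m + 5) * lamP (2 * m + 5) =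
      ((m + 2).factorial : ℝ) ^ 2 * (m + 1).factorial * m.factorial / 4 := by
  have h₁ : (2 * m + 5) % 2 = 1 := by lia
  have h₂ : ¬ 2 * m + 5 = 2 := by lia
  have h₃ : ¬ 2 * m + 5 - 2 = 1 := by lia
  have h₄ : (2 * m + 5 - 2) % 2 = 1 := by lia
  rw [zetaP, lamP, xiP, if_pos h₁, if_neg h₂, if_neg h₃, if_pos h₄,
    show (2 * m + 5 - 1) / 2 = m + 2 by lia, show (2 * m + 5 - 2 - 1) / 2 = m + 1 by lia,
    show (2 * m + 5 - 2 - 3) / 2 = m by lia]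
  ring

lemma add_two_pow_le_exp_four_mul {n : ℕ} (hn : 0 < n) :
    ((n : ℝ) + 2) ^ (2 * n) ≤ Real.exp 1 ^ 4 * (n : ℝ) ^ (2 * n) := by
  have hn' : (0 : ℝ) < n := by exact_mod_cast hn
  have h : (n : ℝ) + 2 ≤ Real.exp (2 / n) * n := by
    calc (n : ℝ) + 2 = (2 / n + 1) * n := by field_simp; ring
      _ ≤ Real.exp (2 / n) * n := by gcongr; exact Real.add_one_le_exp _
  calc ((n : ℝ) + 2) ^ (2 * n) ≤ (Real.exp (2 / n) * n) ^ (2 * n) := by gcongr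
    _ = Real.exp 1 ^ 4 * (n : ℝ) ^ (2 * n) := by
      rw [mul_pow, ← Real.exp_nat_mul, ← Real.exp_nat_mul]
      congr 2
      push_cast
      field_simp
      ring

lemma sqrt_two_mul_add_two_mul_le (x : ℝ) (hx : 0 < x) :
    √(2 * (x + 2)) * x ≤ √(2 * x) * (x + 2) := by
  have hle : √(2 * x) ≤ √(2 * (x + 2)) := Real.sqrt_le_sqrt (by linarith)
  have h₁ : √(2 * x) ^ 2 = 2 * x := Real.sq_sqrt (by linarith)
  have h₂ : √(2 * (x + 2)) ^ 2 = 2 * (x + 2) := Real.sq_sqrt (by linarith)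
  have hprod : 0 ≤ √(2 * x) * √(2 * (x + 2)) * (√(2 * (x + 2)) - √(2 * x)) :=
    mul_nonneg (by positivity) (sub_nonneg.mpr hle)
  linear_combination hprod / 2 - √(2 * (x + 2)) * h₁ / 2 + √(2 * x) * h₂ / 2

lemma DenominatorFreeBound.add_two {n : ℕ} (hn : 0 < n) {g c : ℝ}
    (h : DenominatorFreeBound n g) (hc : 16 * ((n : ℝ) + 2) ^ 4 ≤ 5.88 ^ 4 * c) :
    DenominatorFreeBound (n + 2) (g * c) := by
  have hn' : (0 : ℝ) < n := by exact_mod_cast hn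
  unfold DenominatorFreeBound at *
  have hexp := add_two_pow_le_exp_four_mul hn
  have hsqrt := sqrt_two_mul_add_two_mul_le n hn'
  obtain ⟨k, hk⟩ : ∃ k, 2 * n = k + 1 := ⟨2 * n - 1, by lia⟩
  rw [show 2 * (n + 2) - 1 = k + 4 by lia]
  rw [show 2 * n - 1 = k by lia] at h
  rw [hk] at hexp
  push_cast
  have key : √(2 * ((n : ℝ) + 2)) * ((n : ℝ) + 2) ^ k ≤
      Real.exp 1 ^ 4 * (√(2 * n) * (n : ℝ) ^ k) := by
    refine le_of_mul_le_mul_right ?_ hn'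
    calc √(2 * ((n : ℝ) + 2)) * ((n : ℝ) + 2) ^ k * n
        = √(2 * ((n : ℝ) + 2)) * n * ((n : ℝ) + 2) ^ k := by ring
      _ ≤ √(2 * n) * (n + 2) * ((n : ℝ) + 2) ^ k := by gcongr
      _ = √(2 * n) * ((n : ℝ) + 2) ^ (k + 1) := by ring
      _ ≤ √(2 * n) * (Real.exp 1 ^ 4 * (n : ℝ) ^ (k + 1)) := by gcongr
      _ = Real.exp 1 ^ 4 * (√(2 * n) * (n : ℝ) ^ k) * n := by ring
  calc 8 * √(2 * ((n : ℝ) + 2)) * (2 * ((n : ℝ) + 2)) ^ (k + 4)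
      = 8 * 2 ^ k * (16 * ((n : ℝ) + 2) ^ 4) *
          (√(2 * ((n : ℝ) + 2)) * ((n : ℝ) + 2) ^ k) := by rw [mul_pow]; ring
    _ ≤ 8 * 2 ^ k * (16 * ((n : ℝ) + 2) ^ 4) *
          (Real.exp 1 ^ 4 * (√(2 * n) * (n : ℝ) ^ k)) := by gcongr
    _ = 16 * ((n : ℝ) + 2) ^ 4 * Real.exp 1 ^ 4 * (8 * √(2 * n) * (2 * n) ^ k) := by
      rw [mul_pow]; ring
    _ ≤ 5.88 ^ 4 * c * Real.exp 1 ^ 4 * ((5.88 * Real.exp 1) ^ k * g) := by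
      have : 0 ≤ 5.88 ^ 4 * c := le_trans (by positivity) hc
      gcongr
    _ = (5.88 * Real.exp 1) ^ (k + 4) * (g * c) := by ring

/-- Numerical criterion for `DenominatorFreeBound`, with `5.88 * 2.7182 = 15.983016`. -/
lemma DenominatorFreeBound.of_rational (n : ℕ) {g s : ℝ} (hg : 0 ≤ g) (hs : 0 ≤ s)
    (hns : 2 * (n : ℝ) ≤ s ^ 2)
    (h : 8 * s * (2 * (n : ℝ)) ^ (2 * n - 1) ≤ 15.983016 ^ (2 * n - 1) * g) :
    DenominatorFreeBound n g := by
  have he : (15.983016 : ℝ) ≤ 5.88 * Real.exp 1 := by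
    linarith [Real.exp_one_gt_d9]
  calc 8 * √(2 * (n : ℝ)) * (2 * (n : ℝ)) ^ (2 * n - 1)
      ≤ 8 * s * (2 * (n : ℝ)) ^ (2 * n - 1) := by
        gcongr
        exact Real.sqrt_le_iff.mpr ⟨hs, hns⟩
    _ ≤ 15.983016 ^ (2 * n - 1) * g := h
    _ ≤ (5.88 * Real.exp 1) ^ (2 * n - 1) * g := by gcongr

lemma denominatorFreeBound_even (m : ℕ) :
    DenominatorFreeBound (2 * m + 4) (zetaP (2 * m + 4) * lamP (2 * m + 4)) := by
  rcases lt_or_ge m 2 with hm | hm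
  · refine .of_rational _ (s := 3.5) (zetaP_mul_lamP_pos _).le (by norm_num) ?_ ?_
    · interval_cases m <;> norm_num
    · rw [zetaP_mul_lamP_even]
      interval_cases m <;> norm_num [Nat.factorial]
  · induction m, hm using Nat.le_induction with
    | base =>
      refine .of_rational _ (s := 4) (zetaP_mul_lamP_pos _).le (by norm_num) (by norm_num) ?_
      rw [zetaP_mul_lamP_even]
      norm_num [Nat.factorial]
    | succ m hm ih =>
      have hm' : (2 : ℝ) ≤ m := by exact_mod_cast hm
      have hrec : zetaP (2 * (m + 1) + 4) * lamP (2 * (m + 1) + 4) =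
          zetaP (2 * m + 4) * lamP (2 * m + 4) * ((m + 3) * (m + 2) * (m + 1) ^ 2) := by
        rw [zetaP_mul_lamP_even, zetaP_mul_lamP_even]
        push_cast [Nat.factorial_succ]
        ring
      rw [hrec, show 2 * (m + 1) + 4 = 2 * m + 4 + 2 by ring]
      refine ih.add_two (by lia) ?_
      obtain ⟨x, hx, hmx⟩ : ∃ x : ℝ, 0 ≤ x ∧ (m : ℝ) = x + 2 := ⟨m - 2, by linarith, by ring⟩
      push_cast
      rw [hmx, ← sub_nonneg]
      ring_nf
      positivity

lemma denominatorFreeBound_odd (m : ℕ) :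
    DenominatorFreeBound (2 * m + 5) (zetaP (2 * m + 5) * lamP (2 * m + 5)) := by
  rcases m.eq_zero_or_pos with rfl | hm
  · refine .of_rational _ (s := 3.2) (zetaP_mul_lamP_pos _).le (by norm_num) (by norm_num) ?_
    rw [zetaP_mul_lamP_odd]
    norm_num [Nat.factorial]
  · induction m, hm using Nat.le_induction with
    | base =>
      refine .of_rational _ (s := 3.8) (zetaP_mul_lamP_pos _).le (by norm_num) (by norm_num) ?_
      rw [zetaP_mul_lamP_odd]
      norm_num [Nat.factorial]
    | succ m hm ih =>
      have hm' : (1 : ℝ) ≤ m := by exact_mod_cast hm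
      have hrec : zetaP (2 * (m + 1) + 5) * lamP (2 * (m + 1) + 5) =
          zetaP (2 * m + 5) * lamP (2 * m + 5) * ((m + 3) ^ 2 * (m + 2) * (m + 1)) := by
        rw [zetaP_mul_lamP_odd, zetaP_mul_lamP_odd]
        push_cast [Nat.factorial_succ]
        ring
      rw [hrec, show 2 * (m + 1) + 5 = 2 * m + 5 + 2 by ring]
      refine ih.add_two (by lia) ?_
      obtain ⟨x, hx, hmx⟩ : ∃ x : ℝ, 0 ≤ x ∧ (m : ℝ) = x + 1 := ⟨m - 1, by linarith, by ring⟩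
      push_cast
      rw [hmx, ← sub_nonneg]
      ring_nf
      positivity

lemma denominatorFreeBound {n : ℕ} (hn : 2 ≤ n) :
    DenominatorFreeBound n (zetaP n * lamP n) := by
  by_cases h : n < 4
  · refine .of_rational _ (s := 2.5) (zetaP_mul_lamP_pos _).le (by norm_num) ?_ ?_
    · interval_cases n <;> norm_num
    · interval_cases n <;> norm_num [zetaP, lamP, xiP]
  · obtain ⟨m, rfl | rfl⟩ : ∃ m, n = 2 * m + 4 ∨ n = 2 * m + 5 := ⟨(n - 4) / 2, by lia⟩
    · exact denominatorFreeBound_even m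
    · exact denominatorFreeBound_odd m

theorem stmt19 (n : ℕ) (hn : 2 ≤ n) :
    (8 * Real.sqrt (2 * (n : ℝ)) / (zetaP n * lamP n)) ^ ((1 : ℝ) / (2 * (n : ℝ) - 1))
      ≤ 5.88 * Real.exp 1 / (2 * (n : ℝ)) := by
  have hn' : (2 : ℝ) ≤ n := by exact_mod_cast hn
  have hG := zetaP_mul_lamP_pos n
  have hcast : 2 * (n : ℝ) - 1 = ((2 * n - 1 : ℕ) : ℝ) := by
    rw [Nat.cast_sub (by lia)]
    push_cast
    ring
  have hbase : 8 * √(2 * (n : ℝ)) / (zetaP n * lamP n) ≤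
      (5.88 * Real.exp 1 / (2 * (n : ℝ))) ^ (2 * n - 1) := by
    rw [div_pow, div_le_div_iff₀ hG (by positivity)]
    exact denominatorFreeBound hn
  rw [hcast, one_div]
  calc (8 * √(2 * (n : ℝ)) / (zetaP n * lamP n)) ^ (((2 * n - 1 : ℕ) : ℝ)⁻¹)
      ≤ ((5.88 * Real.exp 1 / (2 * (n : ℝ))) ^ (2 * n - 1)) ^ (((2 * n - 1 : ℕ) : ℝ)⁻¹) := by
        gcongr
    _ = 5.88 * Real.exp 1 / (2 * (n : ℝ)) :=
        Real.pow_rpow_inv_natCast (by positivity) (by lia)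
end
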